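/- arXiv:1809.00714 — 2 statements merged into one kernel-verified Lean document; each statement's English description precedes it below -/
import Mathlib

section
/- Let N ≥ 2, p ∈ [2,∞), q = (N+2)/(N+p), and let Ω ⊂ ℝ^N be a bounded open set. If v is three times continuously differentiable on an open neighborhood U of closure(Ω), then there exist constants C > 0 and ε₀ > 0 such that for all 0 < ε < ε₀ and all x ∈ closure(Ω) (so that closure(B_ε(x)) ⊂ U), |2(N+p)·(M^ε v(x) − v(x)) − ε²·D_p v(x)| ≤ C·ε³; that is, 2(N+p)(M^ε v(x) − v(x))/ε² = D_p v(x) + O(ε) uniformly on closure(Ω) as ε → 0. -/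
open MeasureTheory Metric Set
open scoped ENNReal NNReal Classical

noncomputable section

abbrev EucN (N : ℕ) := EuclideanSpace ℝ (Fin N)

variable {N : ℕ}

/-- The directional mean value operator `M^ε_ξ v (x)`. -/
def mveOp (q ε : ℝ) (v : EucN N → ℝ) (ξ x : EucN N) : ℝ :=
  q * (⨍ y in ball x ε, v y) + (1 - q) * ((v (x + ε • ξ) + v (x - ε • ξ)) / 2)

/-- The mean value operator `M^ε v (x) = sup_{|ξ|=1} M^ε_ξ v (x)`. -/
def mvOp (q ε : ℝ) (v : EucN N → ℝ) (x : EucN N) : ℝ :=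
  ⨆ ξ : sphere (0 : EucN N) 1, mveOp q ε v (ξ : EucN N) x

/-- The quadratic form of the Hessian of `v` at `x` evaluated at `ξ`. -/
def hessQF (v : EucN N → ℝ) (x ξ : EucN N) : ℝ := iteratedFDeriv ℝ 2 v x ![ξ, ξ]

/-- The dominative p-Laplacian `D_p v (x) = Δv(x) + (p-2) λ_max (D²v(x))`. -/
def domLap (p : ℝ) (v : EucN N → ℝ) (x : EucN N) : ℝ :=
  (∑ i : Fin N, hessQF v x (EuclideanSpace.single i 1)) +
    (p - 2) * ⨆ ξ : sphere (0 : EucN N) 1, hessQF v x (ξ : EucN N)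

/-- Second order Taylor expansion on a ball where the second derivative is Lipschitz at the
center. -/
theorem taylor_two_of_closedBall {E : Type*} [NormedAddCommGroup E] [NormedSpace ℝ E]
    {v : E → ℝ} {x : E} {r L : ℝ} (hv : ∀ y ∈ closedBall x r, ContDiffAt ℝ 2 v y) (hL : 0 ≤ L)
    (hlip : ∀ y ∈ closedBall x r,
      ‖fderiv ℝ (fderiv ℝ v) y - fderiv ℝ (fderiv ℝ v) x‖ ≤ L * ‖y - x‖)
    {y : E} (hy : y ∈ closedBall x r) :
    ‖v y - v x - fderiv ℝ v x (y - x) - (1 / 2) * fderiv ℝ (fderiv ℝ v) x (y - x) (y - x)‖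
      ≤ L * r ^ 3 := by
  have hr : 0 ≤ r := dist_nonneg.trans hy
  have hx : x ∈ closedBall x r := mem_closedBall_self hr
  have hconv : Convex ℝ (closedBall x r) := convex_closedBall x r
  have hnorm : ∀ z ∈ closedBall x r, ‖z - x‖ ≤ r := fun z hz ↦ by
    simpa [dist_eq_norm] using hz
  set B := fderiv ℝ (fderiv ℝ v) x
  have hsymm : ∀ a b, B a b = B b a := by
    intro a b
    exact (hv x hx).isSymmSndFDerivAt (by simp) a b
  have hfirst : ∀ z ∈ closedBall x r, ‖fderiv ℝ v z - fderiv ℝ v x - B (z - x)‖ ≤ L * r ^ 2 := by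
    intro z hz
    have h := hconv.norm_image_sub_le_of_norm_hasFDerivWithin_le' (f := fderiv ℝ v)
      (f' := fderiv ℝ (fderiv ℝ v)) (φ := B) (C := L * r)
      (fun w hw ↦ ((((hv w hw).fderiv_right (m := 1) (by norm_num)).differentiableAt
        (by norm_num)).hasFDerivAt).hasFDerivWithinAt)
      (fun w hw ↦ (hlip w hw).trans (mul_le_mul_of_nonneg_left (hnorm w hw) hL)) hx hz
    refine h.trans ?_
    calc L * r * ‖z - x‖ ≤ L * r * r := by gcongr; exact hnorm z hz
      _ = L * r ^ 2 := by ring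
  set R : E → ℝ := fun z ↦ v z - fderiv ℝ v x (z - x) - (1 / 2) * B (z - x) (z - x) with hR
  have hderiv : ∀ z ∈ closedBall x r,
      HasFDerivAt R (fderiv ℝ v z - fderiv ℝ v x - B (z - x)) z := by
    intro z hz
    have h0 : HasFDerivAt v (fderiv ℝ v z) z :=
      ((hv z hz).differentiableAt (by norm_num)).hasFDerivAt
    have hs : HasFDerivAt (fun w ↦ w - x) (ContinuousLinearMap.id ℝ E) z :=
      (hasFDerivAt_id z).sub_const x
    have h1 : HasFDerivAt (fun w ↦ fderiv ℝ v x (w - x)) _ z :=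
      (fderiv ℝ v x).hasFDerivAt.comp z hs
    have h2 : HasFDerivAt (fun w ↦ B (w - x)) _ z := B.hasFDerivAt.comp z hs
    have h3 := (h2.clm_apply hs).const_mul (1 / 2 : ℝ)
    refine ((h0.sub h1).sub h3).congr_fderiv ?_
    ext w
    have hw := hsymm w (z - x)
    simp only [map_sub, FunLike.coe_sub, Pi.sub_apply] at hw
    simp
    linear_combination (1 / 2) * hw
  have h := hconv.norm_image_sub_le_of_norm_hasFDerivWithin_le
    (fun z hz ↦ (hderiv z hz).hasFDerivWithinAt) hfirst hx hy
  have hRx : R y - R x =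
      v y - v x - fderiv ℝ v x (y - x) - (1 / 2) * B (y - x) (y - x) := by
    simp [hR]; ring
  rw [← hRx]
  refine h.trans ?_
  calc L * r ^ 2 * ‖y - x‖ ≤ L * r ^ 2 * r := by gcongr; exact hnorm y hy
    _ = L * r ^ 3 := by ring

set_option maxSynthPendingDepth 3 in
/-- A `C³` function satisfies a second order Taylor expansion with cubic remainder, uniformly on
compact sets. -/
theorem exists_uniform_taylor_two {E : Type*} [NormedAddCommGroup E] [NormedSpace ℝ E]
    [ProperSpace E] {K U : Set E} (hK : IsCompact K) (hU : IsOpen U) (hKU : K ⊆ U)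
    {v : E → ℝ} (hv : ContDiffOn ℝ 3 v U) :
    ∃ L > 0, ∃ δ > 0, ∀ r < δ, ∀ x ∈ K, closedBall x r ⊆ U ∧ ∀ y ∈ closedBall x r,
      ‖v y - v x - fderiv ℝ v x (y - x) - (1 / 2) * fderiv ℝ (fderiv ℝ v) x (y - x) (y - x)‖
        ≤ L * r ^ 3 := by
  obtain ⟨δ, hδ, hsub⟩ := hK.exists_cthickening_subset_open hU hKU
  have hat : ∀ y ∈ U, ContDiffAt ℝ 3 v y := fun y hy ↦ hv.contDiffAt (hU.mem_nhds hy)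
  have hat2 : ∀ y ∈ U, ContDiffAt ℝ 1 (fderiv ℝ (fderiv ℝ v)) y := fun y hy ↦
    ((hat y hy).fderiv_right (m := 2) (by norm_num)).fderiv_right (m := 1) (by norm_num)
  have hcont : ContinuousOn (fderiv ℝ (fderiv ℝ (fderiv ℝ v))) (cthickening δ K) := fun y hy ↦
    (((hat2 y (hsub hy)).fderiv_right (m := 0) (by norm_num)).continuousAt).continuousWithinAt
  obtain ⟨L, hL⟩ := hK.cthickening.exists_bound_of_continuousOn hcont
  refine ⟨max L 1, by positivity, δ, hδ, fun r hr x hx ↦ ?_⟩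
  have hball : closedBall x r ⊆ cthickening δ K :=
    (closedBall_subset_closedBall hr.le).trans (closedBall_subset_cthickening hx δ)
  refine ⟨hball.trans hsub, fun y hy ↦ ?_⟩
  refine taylor_two_of_closedBall
    (fun z hz ↦ (hat z (hsub (hball hz))).of_le (by norm_num)) (by positivity) ?_ hy
  intro z hz
  exact (convex_closedBall x r).norm_image_sub_le_of_norm_fderiv_le
    (fun w hw ↦ (hat2 w (hsub (hball hw))).differentiableAt (by norm_num))
    (fun w hw ↦ (hL w (hball hw)).trans (le_max_left _ _))
    (mem_closedBall_self (dist_nonneg.trans hz)) hz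

theorem LinearIsometryEquiv.setIntegral_ball_comp {E F : Type*} [NormedAddCommGroup E]
    [InnerProductSpace ℝ E] [FiniteDimensional ℝ E] [MeasurableSpace E] [BorelSpace E]
    [NormedAddCommGroup F] [NormedSpace ℝ F] (T : E ≃ₗᵢ[ℝ] E) (r : ℝ) (g : E → F) :
    ∫ y in ball 0 r, g (T y) = ∫ y in ball 0 r, g y := by
  have h := T.measurePreserving.setIntegral_preimage_emb
    T.toHomeomorph.measurableEmbedding g (ball 0 r)
  rwa [T.preimage_ball, map_zero] at h

theorem setIntegral_ball_clm {E : Type*} [NormedAddCommGroup E]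
    [InnerProductSpace ℝ E] [FiniteDimensional ℝ E] [MeasurableSpace E] [BorelSpace E]
    (A : E →L[ℝ] ℝ) (r : ℝ) : ∫ y in ball 0 r, A y = 0 := by
  have h := (LinearIsometryEquiv.neg ℝ (E := E)).setIntegral_ball_comp r A
  simp only [LinearIsometryEquiv.coe_neg, map_neg, integral_neg] at h
  linarith

theorem setIntegral_ball_norm_sq {E : Type*} [NormedAddCommGroup E]
    [InnerProductSpace ℝ E] [FiniteDimensional ℝ E] [Nontrivial E] [MeasurableSpace E]
    [BorelSpace E] {r : ℝ} (hr : 0 < r) :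
    ∫ y in ball (0 : E) r, ‖y‖ ^ 2 = volume.real (ball (0 : E) r) *
      (Module.finrank ℝ E * r ^ 2 / (Module.finrank ℝ E + 2)) := by
  have hd : 0 < Module.finrank ℝ E := Module.finrank_pos
  set f : ℝ → ℝ := (Iio r).indicator fun t ↦ t ^ 2 with hf
  have h1 : ∫ y in ball (0 : E) r, ‖y‖ ^ 2 = ∫ y : E, f ‖y‖ := by
    rw [← integral_indicator measurableSet_ball]
    congr 1 with y
    simp [hf, indicator]
  have h2 : ∫ t in Ioi (0 : ℝ), t ^ (Module.finrank ℝ E - 1) • f t =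
      r ^ (Module.finrank ℝ E + 2) / (Module.finrank ℝ E + 2) := by
    have : ∀ t : ℝ, t ^ (Module.finrank ℝ E - 1) • f t =
        (Iio r).indicator (fun t ↦ t ^ (Module.finrank ℝ E + 1)) t := by
      intro t
      by_cases ht : t ∈ Iio r
      · simp only [hf, indicator_of_mem ht, smul_eq_mul, ← pow_add]
        congr 1; omega
      · simp [hf, indicator_of_notMem ht]
    simp only [this]
    rw [setIntegral_indicator measurableSet_Iio, Ioi_inter_Iio, ← integral_Ioc_eq_integral_Ioo,
      ← intervalIntegral.integral_of_le hr.le, integral_pow]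
    push_cast
    simp
    ring
  rw [h1, integral_fun_norm_addHaar, h2, measureReal_def, measureReal_def,
    Measure.addHaar_ball _ _ hr.le, ENNReal.toReal_mul, ENNReal.toReal_ofReal (by positivity)]
  simp only [nsmul_eq_mul, smul_eq_mul]
  ring

theorem integrableOn_ball_of_continuous {E F : Type*} [NormedAddCommGroup E]
    [InnerProductSpace ℝ E] [FiniteDimensional ℝ E] [MeasurableSpace E] [BorelSpace E]
    [NormedAddCommGroup F] {g : E → F} {x : E} {r : ℝ} (hg : ContinuousOn g (closedBall x r)) :
    IntegrableOn g (ball x r) :=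
  (hg.integrableOn_compact (isCompact_closedBall x r)).mono_set ball_subset_closedBall

theorem setIntegral_ball_coord_mul_of_ne {r : ℝ} {i j : Fin N} (hij : i ≠ j) :
    ∫ y in ball (0 : EucN N) r, y i * y j = 0 := by
  have h := (LinearIsometryEquiv.piLpCongrRight 2 fun k : Fin N ↦
    if k = i then LinearIsometryEquiv.neg ℝ (E := ℝ) else
      LinearIsometryEquiv.refl ℝ ℝ).setIntegral_ball_comp r fun y : EucN N ↦ y i * y j
  simp [hij.symm, integral_neg] at h
  linarith

theorem setIntegral_ball_coord_sq_eq (r : ℝ) (i j : Fin N) :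
    ∫ y in ball (0 : EucN N) r, y i ^ 2 = ∫ y in ball (0 : EucN N) r, y j ^ 2 := by
  have h := (LinearIsometryEquiv.piLpCongrLeft 2 ℝ ℝ
    (Equiv.swap i j)).setIntegral_ball_comp r fun y : EucN N ↦ y j ^ 2
  rw [← h]
  simp [LinearIsometryEquiv.piLpCongrLeft_apply, Equiv.piCongrLeft']

theorem setIntegral_ball_coord_sq {r : ℝ} (hr : 0 < r) (i : Fin N) :
    ∫ y in ball (0 : EucN N) r, y i ^ 2 =
      volume.real (ball (0 : EucN N) r) * (r ^ 2 / (N + 2)) := by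
  have : NeZero N := ⟨fun h ↦ (h ▸ i).elim0⟩
  have hN : (N : ℝ) ≠ 0 := NeZero.ne _
  have h := setIntegral_ball_norm_sq (E := EucN N) hr
  simp only [EuclideanSpace.real_norm_sq_eq] at h
  rw [integral_finsetSum _ fun j _ ↦ integrableOn_ball_of_continuous (by fun_prop),
    Finset.sum_congr rfl fun j _ ↦ setIntegral_ball_coord_sq_eq r j i] at h
  simp only [Finset.sum_const, Finset.card_univ, Fintype.card_fin, nsmul_eq_mul,
    finrank_euclideanSpace] at h
  apply mul_left_cancel₀ hN
  rw [h]
  ring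

/-- The integral of a quadratic form over a ball is a multiple of its trace. -/
theorem setIntegral_ball_quadratic {r : ℝ} (hr : 0 < r) (B : EucN N →L[ℝ] EucN N →L[ℝ] ℝ) :
    ∫ y in ball (0 : EucN N) r, B y y = volume.real (ball (0 : EucN N) r) *
      (r ^ 2 / (N + 2) * ∑ i, B (EuclideanSpace.single i 1) (EuclideanSpace.single i 1)) := by
  have hexp : ∀ y : EucN N, B y y = ∑ i, ∑ j,
      B (EuclideanSpace.single i 1) (EuclideanSpace.single j 1) * (y i * y j) := by
    intro y
    have hy : y = ∑ i, y i • EuclideanSpace.single i (1 : ℝ) := by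
      ext k
      simp [Finset.sum_apply, Pi.single_apply]
    conv_lhs => rw [hy]
    simp only [map_sum, map_smul, FunLike.coe_sum, Finset.sum_apply, FunLike.coe_smul,
      Pi.smul_apply, smul_eq_mul, Finset.mul_sum]
    rw [Finset.sum_comm]
    exact Finset.sum_congr rfl fun i _ ↦ Finset.sum_congr rfl fun j _ ↦ by ring
  conv_lhs => simp only [hexp]
  rw [integral_finsetSum _ fun i _ ↦ integrableOn_ball_of_continuous (by fun_prop)]
  simp only [Finset.mul_sum]
  refine Finset.sum_congr rfl fun i _ ↦ ?_
  rw [integral_finsetSum _ fun i _ ↦ integrableOn_ball_of_continuous (by fun_prop),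
    Finset.sum_eq_single i]
  · rw [integral_const_mul]
    simp only [← pow_two]
    rw [setIntegral_ball_coord_sq hr]
    ring
  · intro j _ hj
    rw [integral_const_mul, setIntegral_ball_coord_mul_of_ne hj.symm, mul_zero]
  · simp

theorem abs_average_ball_sub_le {v : EucN N → ℝ} {x : EucN N} {r c : ℝ} (hr : 0 < r)
    (hv : ContinuousOn v (closedBall x r)) (A : EucN N →L[ℝ] ℝ)
    (B : EucN N →L[ℝ] EucN N →L[ℝ] ℝ)
    (hT : ∀ y ∈ closedBall x r,
      ‖v y - v x - A (y - x) - (1 / 2) * B (y - x) (y - x)‖ ≤ c) :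
    |(⨍ y in ball x r, v y) - v x - r ^ 2 / (2 * (N + 2)) *
      ∑ i, B (EuclideanSpace.single i 1) (EuclideanSpace.single i 1)| ≤ c := by
  have hV : 0 < volume.real (ball x r) :=
    ENNReal.toReal_pos (measure_ball_pos volume x hr).ne' measure_ball_lt_top.ne
  have hshift : ∀ g : EucN N → ℝ, ∫ y in ball x r, g (y - x) = ∫ y in ball 0 r, g y := by
    intro g
    have h := (measurePreserving_sub_right volume x).setIntegral_preimage_emb
      (Homeomorph.subRight x).measurableEmbedding g (ball 0 r)
    convert h using 3
    ext y
    simp [dist_eq_norm]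
  have hVx : volume.real (ball x r) = volume.real (ball (0 : EucN N) r) := by
    simp [measureReal_def, Measure.addHaar_ball_center volume x r]
  have hint := norm_setIntegral_le_of_norm_le_const (μ := volume) (s := ball x r)
    measure_ball_lt_top fun y hy ↦ hT y (ball_subset_closedBall hy)
  have hi1 : IntegrableOn v (ball x r) := integrableOn_ball_of_continuous hv
  have hi2 : IntegrableOn (fun _ ↦ v x) (ball x r) :=
    integrableOn_ball_of_continuous (by fun_prop)
  have hi3 : IntegrableOn (fun y ↦ A (y - x)) (ball x r) :=
    integrableOn_ball_of_continuous (by fun_prop)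
  have hi4 : IntegrableOn (fun y ↦ (1 / 2) * B (y - x) (y - x)) (ball x r) :=
    integrableOn_ball_of_continuous (by fun_prop)
  have hi12 : IntegrableOn (fun y ↦ v y - v x) (ball x r) := hi1.sub hi2
  have hi123 : IntegrableOn (fun y ↦ v y - v x - A (y - x)) (ball x r) := hi12.sub hi3
  rw [integral_sub hi123 hi4, integral_sub hi12 hi3,
    integral_sub hi1 hi2, integral_const_mul, hshift fun y ↦ A y, hshift fun y ↦ B y y,
    setIntegral_ball_clm, setIntegral_ball_quadratic hr, setIntegral_const, ← hVx,
    smul_eq_mul, Real.norm_eq_abs] at hint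
  rw [setAverage_eq, smul_eq_mul]
  set S := ∑ i, B (EuclideanSpace.single i 1) (EuclideanSpace.single i 1)
  set V := volume.real (ball x r)
  have hfac : V⁻¹ * (∫ y in ball x r, v y) - v x - r ^ 2 / (2 * (N + 2)) * S =
      V⁻¹ * ((∫ y in ball x r, v y) - V * v x - 0 - 1 / 2 * (V * (r ^ 2 / (N + 2) * S))) := by
    field_simp
    ring
  rw [hfac, abs_mul, abs_of_pos (inv_pos.2 hV), inv_mul_le_iff₀ hV, mul_comm V c]
  exact hint

theorem abs_symmetric_mean_sub_le {E : Type*} [NormedAddCommGroup E] [NormedSpace ℝ E]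
    {v : E → ℝ} {x ξ : E} {r c : ℝ} (hr : 0 ≤ r) (hξ : ‖ξ‖ = 1) (A : E →L[ℝ] ℝ)
    (B : E →L[ℝ] E →L[ℝ] ℝ)
    (hT : ∀ y ∈ closedBall x r,
      ‖v y - v x - A (y - x) - (1 / 2) * B (y - x) (y - x)‖ ≤ c) :
    |(v (x + r • ξ) + v (x - r • ξ)) / 2 - v x - r ^ 2 / 2 * B ξ ξ| ≤ c := by
  have h1 := hT (x + r • ξ) (by simp [norm_smul, hξ, abs_of_nonneg hr])
  have h2 := hT (x - r • ξ) (by simp [norm_smul, hξ, abs_of_nonneg hr])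
  simp only [add_sub_cancel_left, sub_sub_cancel_left, map_smul, map_neg, smul_eq_mul,
    Real.norm_eq_abs, FunLike.coe_smul, FunLike.coe_neg, Pi.smul_apply, Pi.neg_apply] at h1 h2
  rw [abs_le] at *
  constructor <;> linarith

/-- A supremum is stable under uniform perturbation by a nonnegative affine image. -/
theorem abs_iSup_sub_affine_le {ι : Type*} [Nonempty ι] {f g : ι → ℝ} {a b c : ℝ} (hb : 0 ≤ b)
    (hg : BddAbove (range g)) (h : ∀ i, |f i - (a + b * g i)| ≤ c) :
    |(⨆ i, f i) - (a + b * ⨆ i, g i)| ≤ c := by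
  have hle : ∀ i, f i ≤ a + b * (⨆ i, g i) + c := fun i ↦ by
    have := mul_le_mul_of_nonneg_left (le_ciSup hg i) hb
    linarith [(abs_le.1 (h i)).2]
  have hf : BddAbove (range f) := ⟨_, forall_mem_range.2 hle⟩
  have hge : b * (⨆ i, g i) ≤ (⨆ i, f i) + c - a := by
    rw [Real.mul_iSup_of_nonneg hb]
    exact ciSup_le fun i ↦ by linarith [(abs_le.1 (h i)).1, le_ciSup hf i]
  rw [abs_le]
  constructor <;> linarith [ciSup_le hle]

/-- asymptotic expansion
`2(N+p)(M^ε v(x) − v(x))/ε² = D_p v(x) + O(ε)` uniformly on `closure Ω`,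
for `v` three times continuously differentiable on a neighborhood `U` of `closure Ω`. -/
theorem smooth_expansion (hN : 2 ≤ N) (p q : ℝ) (hp : 2 ≤ p)
    (hq : q = ((N : ℝ) + 2) / ((N : ℝ) + p))
    (Ω : Set (EucN N)) (hΩo : IsOpen Ω) (hΩb : Bornology.IsBounded Ω)
    (U : Set (EucN N)) (hUo : IsOpen U) (hU : closure Ω ⊆ U)
    (v : EucN N → ℝ) (hv : ContDiffOn ℝ 3 v U) :
    ∃ C > 0, ∃ ε₀ > 0, ∀ ε : ℝ, 0 < ε → ε < ε₀ → ∀ x ∈ closure Ω,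
      Metric.closedBall x ε ⊆ U ∧
      |2 * ((N : ℝ) + p) * (mvOp q ε v x - v x) - ε ^ 2 * domLap p v x| ≤ C * ε ^ 3 := by
  subst hq
  obtain ⟨L, hL, δ, hδ, hT⟩ := exists_uniform_taylor_two hΩb.isCompact_closure hUo hU hv
  have hNp : 0 < (N : ℝ) + p := by positivity
  refine ⟨2 * (N + p) * L, by positivity, δ, hδ, fun ε hε hεδ x hx ↦ ?_⟩
  obtain ⟨hball, hTx⟩ := hT ε hεδ x hx
  refine ⟨hball, ?_⟩
  have hhess : ∀ ξ, hessQF v x ξ = fderiv ℝ (fderiv ℝ v) x ξ ξ := fun ξ ↦ by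
    simp [hessQF, iteratedFDeriv_two_apply]
  have : Nonempty (sphere (0 : EucN N) 1) :=
    ⟨⟨EuclideanSpace.single ⟨0, by omega⟩ 1, by simp⟩⟩
  have hbdd : BddAbove (range fun ξ : sphere (0 : EucN N) 1 ↦ hessQF v x ξ) := by
    refine ⟨‖fderiv ℝ (fderiv ℝ v) x‖, forall_mem_range.2 fun ξ ↦ ?_⟩
    have h := (fderiv ℝ (fderiv ℝ v) x).le_opNorm₂ (ξ : EucN N) ξ
    have hξ : ‖(ξ : EucN N)‖ = 1 := by simp
    rw [hξ, mul_one, mul_one] at h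
    exact (hhess ξ).trans_le ((le_abs_self _).trans h)
  have hmean := abs_average_ball_sub_le hε (hv.continuousOn.mono hball) _ _ hTx
  set S := ∑ i : Fin N, hessQF v x (EuclideanSpace.single i 1) with hS
  simp only [← hhess] at hmean
  rw [← hS] at hmean
  have hpert : ∀ ξ : sphere (0 : EucN N) 1,
      |mveOp (((N : ℝ) + 2) / (N + p)) ε v ξ x - ((v x + ε ^ 2 / (2 * (N + p)) * S) +
        ε ^ 2 * (p - 2) / (2 * (N + p)) * hessQF v x ξ)| ≤ L * ε ^ 3 := by
    intro ξ
    have hdir := abs_symmetric_mean_sub_le hε.le (by simp) _ _ hTx (ξ := (ξ : EucN N))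
    rw [← hhess] at hdir
    set a := (⨍ y in ball x ε, v y) - v x - ε ^ 2 / (2 * (N + 2)) * S with ha
    set b := (v (x + ε • (ξ : EucN N)) + v (x - ε • (ξ : EucN N))) / 2 - v x -
      ε ^ 2 / 2 * hessQF v x ξ with hb
    have hq0 : 0 ≤ ((N : ℝ) + 2) / (N + p) := by positivity
    have hq1 : 0 ≤ 1 - ((N : ℝ) + 2) / (N + p) := by
      rw [sub_nonneg, div_le_one hNp]; linarith
    have hsplit : mveOp (((N : ℝ) + 2) / (N + p)) ε v ξ x -
        ((v x + ε ^ 2 / (2 * (N + p)) * S) +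
          ε ^ 2 * (p - 2) / (2 * (N + p)) * hessQF v x ξ) =
        ((N : ℝ) + 2) / (N + p) * a + (1 - ((N : ℝ) + 2) / (N + p)) * b := by
      simp only [mveOp, ha, hb]
      field_simp
      ring
    rw [hsplit]
    calc _ ≤ ((N : ℝ) + 2) / (N + p) * |a| + (1 - ((N : ℝ) + 2) / (N + p)) * |b| := by
          refine (abs_add_le _ _).trans_eq ?_
          rw [abs_mul, abs_mul, abs_of_nonneg hq0, abs_of_nonneg hq1]
      _ ≤ ((N : ℝ) + 2) / (N + p) * (L * ε ^ 3) +
          (1 - ((N : ℝ) + 2) / (N + p)) * (L * ε ^ 3) := by gcongr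
      _ = L * ε ^ 3 := by ring
  have hcoef : 0 ≤ ε ^ 2 * (p - 2) / (2 * (N + p)) :=
    div_nonneg (mul_nonneg (sq_nonneg ε) (sub_nonneg.2 hp)) (by positivity)
  have hsup := abs_iSup_sub_affine_le hcoef hbdd hpert
  have hfactor : 2 * ((N : ℝ) + p) * (mvOp (((N : ℝ) + 2) / (N + p)) ε v x - v x) -
      ε ^ 2 * domLap p v x = 2 * (N + p) *
        ((⨆ ξ : sphere (0 : EucN N) 1, mveOp (((N : ℝ) + 2) / (N + p)) ε v ξ x) -
          ((v x + ε ^ 2 / (2 * (N + p)) * S) + ε ^ 2 * (p - 2) / (2 * (N + p)) *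
            ⨆ ξ : sphere (0 : EucN N) 1, hessQF v x ξ)) := by
    simp only [mvOp, domLap, ← hS]
    field_simp
    ring
  rw [hfactor, abs_mul, abs_of_pos (by positivity), mul_assoc (2 * ((N : ℝ) + p))]
  gcongr

end
end

section
/- Let σ : closure(Ω) → S^{N−1} be a Borel control, x₀ ∈ Ω_ε, and fix y₀ ∈ ℝ^N. Then the sequence of random variables ( |x_{n∧τ_σ} − y₀|² − c_{N,p}·(n∧τ_σ)·ε² )_{n≥1}, where c_{N,p} := (N+p−2)/(N+p), is a martingale under P^{x₀}_σ with respect to the natural filtration {F_n}_{n≥1}. -/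
open MeasureTheory Metric Set
open scoped ENNReal NNReal Classical

noncomputable section

variable {N : ℕ}

/-- `Ω_ε = {x : dist(x,Ω) ≤ ε}`. -/
def Oeps (Ω : Set (EucN N)) (ε : ℝ) : Set (EucN N) := {x | Metric.infDist x Ω ≤ ε}

/-- `Γ_ε = Ω_ε \ closure Ω`. -/
def Geps (Ω : Set (EucN N)) (ε : ℝ) : Set (EucN N) := Oeps Ω ε \ closure Ω

/-- a Borel control with values in the unit sphere -/
def IsControl (σ : EucN N → EucN N) : Prop := Measurable σ ∧ ∀ x, ‖σ x‖ = 1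

/-- the transition probability measures `γ_σ[x]` -/
def gamKer (q ε : ℝ) (Ω : Set (EucN N)) (σ : EucN N → EucN N) (x : EucN N) :
    Measure (EucN N) :=
  if x ∈ closure Ω then
    ENNReal.ofReal q • ((volume (ball x ε))⁻¹ • volume.restrict (ball x ε)) +
      ENNReal.ofReal ((1 - q) / 2) •
        (Measure.dirac (x + ε • σ x) + Measure.dirac (x - ε • σ x))
  else Measure.dirac x

/-- probability of the cylinder `{ω : ω i ∈ A i, i ≤ n}` for the chain started at `x`
with transitions `γ`. -/
def cylProb (γ : EucN N → Measure (EucN N)) : ℕ → EucN N → (ℕ → Set (EucN N)) → ℝ≥0∞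
  | 0, x, A => (A 0).indicator 1 x
  | n + 1, x, A => (A 0).indicator 1 x * ∫⁻ y, cylProb γ n y (fun i => A (i + 1)) ∂(γ x)

/-- `P` is the trajectory (Ionescu-Tulcea/Kolmogorov) measure of the chain started at
`x₀` with transition kernel `γ`. -/
def IsTrajMeasure (γ : EucN N → Measure (EucN N)) (x₀ : EucN N)
    (P : Measure (ℕ → EucN N)) : Prop :=
  IsProbabilityMeasure P ∧
    ∀ (n : ℕ) (A : ℕ → Set (EucN N)), (∀ i, MeasurableSet (A i)) →
      P {ω | ∀ i ≤ n, ω i ∈ A i} = cylProb γ n x₀ A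

/-- the natural filtration of the coordinate process -/
def trajFilt (N : ℕ) : Filtration ℕ (MeasurableSpace.pi : MeasurableSpace (ℕ → EucN N)) :=
  Filtration.natural (fun n (ω : ℕ → EucN N) => ω n)
    (fun n => (measurable_pi_apply n).stronglyMeasurable)

/-- `n ∧ τ`, where `τ = min{k : ω k ∈ Γ}` is the hitting time of `Γ`. -/
def stopMin (Γ : Set (EucN N)) (n : ℕ) (ω : ℕ → EucN N) : ℕ :=
  sInf ({k | ω k ∈ Γ} ∪ {n})

/-- Expectation of `f (x_n)` over the cylinder `x_i ∈ A i`, `i ≤ n`, for the chain started at `x`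
with transitions `γ`. -/
def cylExp (γ : EucN N → Measure (EucN N)) :
    ℕ → EucN N → (ℕ → Set (EucN N)) → (EucN N → ℝ≥0∞) → ℝ≥0∞
  | 0, x, A, f => (A 0).indicator 1 x * f x
  | n + 1, x, A, f =>
      (A 0).indicator 1 x * ∫⁻ y, cylExp γ n y (fun i => A (i + 1)) f ∂(γ x)

lemma measurable_cylExp {γ : EucN N → Measure (EucN N)} (hγ : Measurable γ) (n : ℕ) :
    ∀ {A : ℕ → Set (EucN N)}, (∀ i, MeasurableSet (A i)) →
      ∀ {f : EucN N → ℝ≥0∞}, Measurable f → Measurable fun x => cylExp γ n x A f := by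
  induction n with
  | zero =>
    intro A hA f hf
    exact (measurable_one.indicator (hA 0)).mul hf
  | succ n ih =>
    intro A hA f hf
    exact (measurable_one.indicator (hA 0)).mul
      ((Measure.measurable_lintegral (ih (fun i => hA (i + 1)) hf)).comp hγ)

lemma cylExp_indicator {γ : EucN N → Measure (EucN N)} (hγ : Measurable γ) (n : ℕ) :
    ∀ {A : ℕ → Set (EucN N)}, (∀ i, MeasurableSet (A i)) →
      ∀ {B : Set (EucN N)}, MeasurableSet B → ∀ (c : ℝ≥0∞) (x : EucN N),
      cylExp γ n x A (B.indicator fun _ => c)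
        = c * cylProb γ n x (Function.update A n (A n ∩ B)) := by
  induction n with
  | zero =>
    intro A hA B hB c x
    by_cases h1 : x ∈ A 0 <;> by_cases h2 : x ∈ B <;> simp [cylExp, cylProb, h1, h2]
  | succ n ih =>
    intro A hA B hB c x
    have hshift : (fun i => Function.update A (n + 1) (A (n + 1) ∩ B) (i + 1))
        = Function.update (fun i => A (i + 1)) n (A (n + 1) ∩ B) := by
      funext i
      by_cases h : i = n
      · subst h; simp
      · rw [Function.update_of_ne h, Function.update_of_ne (by omega)]
    have hne : Function.update A (n + 1) (A (n + 1) ∩ B) 0 = A 0 :=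
      Function.update_of_ne (by omega) _ _
    have key := fun y => ih (fun i => hA (i + 1)) hB c y
    have hm : Measurable fun y => cylExp γ n y (fun i => A (i + 1)) (B.indicator fun _ => 1) :=
      measurable_cylExp hγ n (fun i => hA (i + 1)) (measurable_const.indicator hB)
    have h1 := fun y => ih (fun i => hA (i + 1)) hB 1 y
    simp only [one_mul] at h1
    simp only [h1] at hm
    simp only [cylExp, cylProb, hshift, hne, key]
    rw [lintegral_const_mul _ hm]
    ring

lemma cylExp_add {γ : EucN N → Measure (EucN N)} (hγ : Measurable γ) (n : ℕ) :
    ∀ {A : ℕ → Set (EucN N)}, (∀ i, MeasurableSet (A i)) →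
      ∀ {f g : EucN N → ℝ≥0∞}, Measurable f → ∀ x : EucN N,
      cylExp γ n x A (f + g) = cylExp γ n x A f + cylExp γ n x A g := by
  induction n with
  | zero => intro A hA f g hf x; simp [cylExp, mul_add]
  | succ n ih =>
    intro A hA f g hf x
    simp only [cylExp, ih (fun i => hA (i + 1)) hf]
    rw [lintegral_add_left (measurable_cylExp hγ n (fun i => hA (i + 1)) hf), mul_add]

lemma cylExp_mono (γ : EucN N → Measure (EucN N)) (n : ℕ) :
    ∀ (A : ℕ → Set (EucN N)) {f g : EucN N → ℝ≥0∞}, f ≤ g → ∀ x : EucN N,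
      cylExp γ n x A f ≤ cylExp γ n x A g := by
  induction n with
  | zero => intro A f g hfg x; exact mul_le_mul_right (hfg x) _
  | succ n ih =>
    intro A f g hfg x
    exact mul_le_mul_right (lintegral_mono fun y => ih _ hfg y) _

lemma cylExp_iSup {γ : EucN N → Measure (EucN N)} (hγ : Measurable γ) (n : ℕ) :
    ∀ {A : ℕ → Set (EucN N)}, (∀ i, MeasurableSet (A i)) →
      ∀ {f : ℕ → EucN N → ℝ≥0∞}, (∀ k, Measurable (f k)) → Monotone f → ∀ x : EucN N,
      cylExp γ n x A (fun y => ⨆ k, f k y) = ⨆ k, cylExp γ n x A (f k) := by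
  induction n with
  | zero => intro A hA f hf hm x; simp [cylExp, ENNReal.mul_iSup]
  | succ n ih =>
    intro A hA f hf hm x
    simp only [cylExp, ih (fun i => hA (i + 1)) hf hm]
    rw [lintegral_iSup (fun k => measurable_cylExp hγ n (fun i => hA (i + 1)) (hf k))
      (fun i j hij y => cylExp_mono γ n _ (hm hij) y), ENNReal.mul_iSup]

lemma cylExp_succ {γ : EucN N → Measure (EucN N)} (n : ℕ) :
    ∀ {A : ℕ → Set (EucN N)}, A (n + 1) = univ →
      ∀ (f : EucN N → ℝ≥0∞) (x : EucN N),
      cylExp γ (n + 1) x A f = cylExp γ n x A (fun y => ∫⁻ z, f z ∂(γ y)) := by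
  induction n with
  | zero => intro A hA f x; simp [cylExp, hA]
  | succ n ih =>
    intro A hA f x
    rw [cylExp]
    conv_rhs => rw [cylExp]
    simp only [ih (A := fun i => A (i + 1)) hA]

lemma measurableSet_cylinder (n : ℕ) {A : ℕ → Set (EucN N)} (hA : ∀ i, MeasurableSet (A i)) :
    MeasurableSet {ω : ℕ → EucN N | ∀ i ≤ n, ω i ∈ A i} := by
  have : {ω : ℕ → EucN N | ∀ i ≤ n, ω i ∈ A i} = ⋂ i, ⋂ (_ : i ≤ n), (fun ω => ω i) ⁻¹' A i := by
    ext ω; simp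
  rw [this]
  exact MeasurableSet.iInter fun i => MeasurableSet.iInter fun _ => measurable_pi_apply i (hA i)

lemma IsTrajMeasure.setLIntegral_cylinder {γ : EucN N → Measure (EucN N)} (hγ : Measurable γ)
    {x₀ : EucN N} {P : Measure (ℕ → EucN N)} (hP : IsTrajMeasure γ x₀ P) (n : ℕ)
    {A : ℕ → Set (EucN N)} (hA : ∀ i, MeasurableSet (A i)) {f : EucN N → ℝ≥0∞}
    (hf : Measurable f) :
    ∫⁻ ω in {ω | ∀ i ≤ n, ω i ∈ A i}, f (ω n) ∂P = cylExp γ n x₀ A f := by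
  refine Measurable.ennreal_induction (motive := fun f =>
    ∫⁻ ω in {ω | ∀ i ≤ n, ω i ∈ A i}, f (ω n) ∂P = cylExp γ n x₀ A f)
    (fun c B hB => ?_) (fun f g _ hf hg ihf ihg => ?_) (fun f hf hm ih => ?_) hf
  · rw [cylExp_indicator hγ n hA hB, ← hP.2 n]
    · have : (fun ω : ℕ → EucN N => B.indicator (fun _ => c) (ω n))
          = ((fun ω : ℕ → EucN N => ω n) ⁻¹' B).indicator fun _ => c := rfl
      rw [this, lintegral_indicator_const (measurable_pi_apply n hB),
        Measure.restrict_apply (measurable_pi_apply n hB)]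
      congr 2
      ext ω
      simp only [mem_inter_iff, mem_preimage, mem_ofPred_eq]
      constructor
      · rintro ⟨h1, h2⟩ i hi
        by_cases h : i = n
        · subst h; simpa using ⟨h2 _ le_rfl, h1⟩
        · rw [Function.update_of_ne h]; exact h2 i hi
      · intro h
        have hn := h n le_rfl
        rw [Function.update_self] at hn
        refine ⟨hn.2, fun i hi => ?_⟩
        by_cases h' : i = n
        · subst h'; exact hn.1
        · have := h i hi
          rwa [Function.update_of_ne h'] at this
    · intro i
      by_cases h : i = n
      · subst h; simpa using (hA i).inter hB
      · rw [Function.update_of_ne h]; exact hA i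
  · rw [cylExp_add hγ n hA hf, ← ihf, ← ihg]
    exact lintegral_add_left (hf.comp (measurable_pi_apply n)) _
  · rw [cylExp_iSup hγ n hA hf hm]
    simp only [← ih]
    exact lintegral_iSup (fun k => (hf k).comp (measurable_pi_apply n))
      (fun i j hij ω => hm hij (ω n))

lemma trajFilt_eq_generateFrom (n : ℕ) :
    (trajFilt N n : MeasurableSpace (ℕ → EucN N)) = MeasurableSpace.generateFrom
      {S | ∃ A : ℕ → Set (EucN N), (∀ i, MeasurableSet (A i)) ∧
        S = {ω | ∀ i ≤ n, ω i ∈ A i}} := by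
  change (⨆ j ≤ n, MeasurableSpace.comap (fun ω : ℕ → EucN N => ω j) _) = _
  apply le_antisymm
  · refine iSup₂_le fun j hj => ?_
    rintro _ ⟨B, hB, rfl⟩
    refine MeasurableSpace.measurableSet_generateFrom
      ⟨Function.update (fun _ => univ) j B, fun i => ?_, ?_⟩
    · by_cases h : i = j
      · subst h; simpa using hB
      · rw [Function.update_of_ne h]; exact MeasurableSet.univ
    · ext ω
      simp only [mem_preimage, mem_ofPred_eq]
      constructor
      · intro hω i _
        by_cases h : i = j
        · subst h; simpa using hω
        · rw [Function.update_of_ne h]; trivial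
      · intro h
        simpa using h j hj
  · refine MeasurableSpace.generateFrom_le ?_
    rintro _ ⟨A, hA, rfl⟩
    have : {ω : ℕ → EucN N | ∀ i ≤ n, ω i ∈ A i}
        = ⋂ i, ⋂ (_ : i ≤ n), (fun ω => ω i) ⁻¹' A i := by
      ext ω; simp
    rw [this]
    refine MeasurableSet.iInter fun i => MeasurableSet.iInter fun hi => ?_
    exact (le_iSup₂_of_le (f := fun j (_ : j ≤ n) => MeasurableSpace.comap
      (fun ω : ℕ → EucN N => ω j) inferInstance) i hi le_rfl) _ ⟨A i, hA i, rfl⟩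

/-- The Markov property of the coordinate process, for a nonnegative function of the next state. -/
lemma IsTrajMeasure.setLIntegral_succ {γ : EucN N → Measure (EucN N)} (hγ : Measurable γ)
    {x₀ : EucN N} {P : Measure (ℕ → EucN N)} (hP : IsTrajMeasure γ x₀ P) (n : ℕ)
    {f : EucN N → ℝ≥0∞} (hf : Measurable f) (hfin : ∫⁻ ω, f (ω (n + 1)) ∂P ≠ ∞)
    {S : Set (ℕ → EucN N)} (hS : MeasurableSet[trajFilt N n] S) :
    ∫⁻ ω in S, f (ω (n + 1)) ∂P = ∫⁻ ω in S, ∫⁻ z, f z ∂(γ (ω n)) ∂P := by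
  have hcyl : ∀ A : ℕ → Set (EucN N), (∀ i, MeasurableSet (A i)) →
      ∫⁻ ω in {ω | ∀ i ≤ n, ω i ∈ A i}, f (ω (n + 1)) ∂P
        = ∫⁻ ω in {ω | ∀ i ≤ n, ω i ∈ A i}, ∫⁻ z, f z ∂(γ (ω n)) ∂P := by
    intro A hA
    have hK : Measurable fun y => ∫⁻ z, f z ∂(γ y) := (Measure.measurable_lintegral hf).comp hγ
    let A' := Function.update A (n + 1) univ
    have hA' : ∀ i ≤ n, A' i = A i := fun i hi => Function.update_of_ne (by omega) _ _
    have hA'm : ∀ i, MeasurableSet (A' i) := by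
      intro i
      by_cases h : i = n + 1
      · subst h; simp [A']
      · simpa [A', Function.update_of_ne h] using hA i
    have hset : {ω : ℕ → EucN N | ∀ i ≤ n, ω i ∈ A i} = {ω | ∀ i ≤ n, ω i ∈ A' i} := by
      ext ω
      exact forall₂_congr fun i hi => by rw [hA' i hi]
    have hset' : {ω : ℕ → EucN N | ∀ i ≤ n, ω i ∈ A' i} = {ω | ∀ i ≤ n + 1, ω i ∈ A' i} := by
      ext ω
      refine ⟨fun h i hi => ?_, fun h i hi => h i (by omega)⟩
      rcases Nat.lt_or_ge n i with h' | h'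
      · obtain rfl : i = n + 1 := by omega
        simp [A']
      · exact h i h'
    rw [hset, hP.setLIntegral_cylinder hγ n hA'm hK, hset',
      hP.setLIntegral_cylinder hγ (n + 1) hA'm hf, cylExp_succ n (by simp [A'])]
  have hSm : MeasurableSet S := (trajFilt N).le n _ hS
  rw [← withDensity_apply _ hSm, ← withDensity_apply _ hSm]
  have : IsFiniteMeasure (P.withDensity fun ω => f (ω (n + 1))) :=
    isFiniteMeasure_withDensity hfin
  refine ext_on_measurableSpace_of_generate_finite _ _ ?_ ((trajFilt N).le n)
    (trajFilt_eq_generateFrom n) ?_ ?_ hS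
  · rintro _ ⟨A, hA, rfl⟩
    rw [withDensity_apply _ (measurableSet_cylinder n hA),
      withDensity_apply _ (measurableSet_cylinder n hA), hcyl A hA]
  · rintro _ ⟨A, hA, rfl⟩ _ ⟨B, hB, rfl⟩ _
    refine ⟨fun i => A i ∩ B i, fun i => (hA i).inter (hB i), ?_⟩
    ext ω
    simp only [mem_inter_iff, mem_ofPred_eq]
    exact ⟨fun h i hi => ⟨h.1 i hi, h.2 i hi⟩, fun h => ⟨fun i hi => (h i hi).1,
      fun i hi => (h i hi).2⟩⟩
  · have := hcyl (fun _ => univ) fun _ => MeasurableSet.univ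
    rw [withDensity_apply _ MeasurableSet.univ, withDensity_apply _ MeasurableSet.univ]
    simpa using this

lemma IsTrajMeasure.ae_zero_eq {γ : EucN N → Measure (EucN N)}
    {x₀ : EucN N} {P : Measure (ℕ → EucN N)} (hP : IsTrajMeasure γ x₀ P) :
    ∀ᵐ ω ∂P, ω 0 = x₀ := by
  have := hP.2 0 (fun _ => {x₀}ᶜ) fun _ => (measurableSet_singleton x₀).compl
  rw [ae_iff]
  simpa [cylProb] using this

/-- If each `D n` leads almost surely to `D (n + 1)`, the chain stays in `D`. -/
lemma IsTrajMeasure.ae_mem {γ : EucN N → Measure (EucN N)} (hγ : Measurable γ)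
    {x₀ : EucN N} {P : Measure (ℕ → EucN N)} (hP : IsTrajMeasure γ x₀ P)
    {D : ℕ → Set (EucN N)} (hD : ∀ n, MeasurableSet (D n)) (h0 : x₀ ∈ D 0)
    (hstep : ∀ n, ∀ x ∈ D n, γ x (D (n + 1))ᶜ = 0) (n : ℕ) : ∀ᵐ ω ∂P, ω n ∈ D n := by
  have := hP.1
  induction n with
  | zero => filter_upwards [hP.ae_zero_eq] with ω hω; rwa [hω]
  | succ n ih =>
    have hDm : MeasurableSet ((fun ω : ℕ → EucN N => ω (n + 1)) ⁻¹' (D (n + 1))ᶜ) :=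
      measurable_pi_apply _ (hD (n + 1)).compl
    have hind : ∫⁻ ω, (D (n + 1))ᶜ.indicator (fun _ => 1) (ω (n + 1)) ∂P
        = P ((fun ω : ℕ → EucN N => ω (n + 1)) ⁻¹' (D (n + 1))ᶜ) :=
      (lintegral_indicator_const hDm 1).trans (one_mul _)
    have h := hP.setLIntegral_succ hγ n (f := (D (n + 1))ᶜ.indicator fun _ => 1)
      (measurable_const.indicator (hD (n + 1)).compl) (by rw [hind]; exact measure_ne_top _ _)
      MeasurableSet.univ
    rw [Measure.restrict_univ, hind] at h
    have hz : ∫⁻ ω, ∫⁻ z, (D (n + 1))ᶜ.indicator (fun _ => 1) z ∂(γ (ω n)) ∂P = 0 := by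
      rw [lintegral_congr_ae (g := fun _ => 0), lintegral_zero]
      filter_upwards [ih] with ω hω
      rw [lintegral_indicator_const (hD (n + 1)).compl, hstep n _ hω, mul_zero]
    rw [hz] at h
    exact ae_iff.2 h

lemma measurable_gamKer (q ε : ℝ) (Ω : Set (EucN N)) {σ : EucN N → EucN N}
    (hσ : Measurable σ) : Measurable (gamKer q ε Ω σ) := by
  refine Measure.measurable_of_measurable_coe _ fun B hB => ?_
  have hset : MeasurableSet {z : EucN N × EucN N | dist z.2 z.1 < ε ∧ z.2 ∈ B} :=
    (measurableSet_lt (measurable_snd.dist measurable_fst) measurable_const).inter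
      (measurable_snd hB)
  have h1 : Measurable fun x : EucN N => volume (B ∩ ball x ε) := by
    convert measurable_measure_prodMk_left (ν := (volume : Measure (EucN N))) hset using 2 with x
    congr 1
    ext y
    simp [and_comm]
  have h2 : Measurable fun x : EucN N =>
      ENNReal.ofReal q * ((volume (ball (0 : EucN N) ε))⁻¹ * volume (B ∩ ball x ε))
        + ENNReal.ofReal ((1 - q) / 2)
          * (B.indicator 1 (x + ε • σ x) + B.indicator 1 (x - ε • σ x)) := by
    have hi : Measurable (B.indicator (1 : EucN N → ℝ≥0∞)) := measurable_one.indicator hB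
    refine ((h1.const_mul _).const_mul _).add (Measurable.const_mul (Measurable.add ?_ ?_) _)
    · exact hi.comp (measurable_id.add (hσ.const_smul ε))
    · exact hi.comp (measurable_id.sub (hσ.const_smul ε))
  have h3 : Measurable fun x : EucN N => (B.indicator 1 x : ℝ≥0∞) := measurable_one.indicator hB
  have h4 := @Measurable.ite _ _ _ _ _ _ (fun x => x ∈ closure Ω)
    (fun _ => Classical.propDecidable _) isClosed_closure.measurableSet h2 h3
  convert h4 using 2 with x
  by_cases hx : x ∈ closure Ω
  · simp [gamKer, hx, Measure.restrict_apply hB, Measure.dirac_apply' _ hB,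
      Measure.addHaar_ball_center, mul_add]
  · simp [gamKer, hx, Measure.dirac_apply' _ hB]

lemma integral_ball_norm_sq (hN : 2 ≤ N) {ε : ℝ} (hε : 0 < ε) :
    ∫ z in ball (0 : EucN N) ε, ‖z‖ ^ 2
      = volume.real (ball (0 : EucN N) ε) * (N / (N + 2) * ε ^ 2) := by
  have : Nontrivial (EucN N) := by
    refine Module.nontrivial_of_finrank_pos (R := ℝ) ?_
    rw [finrank_euclideanSpace_fin]; omega
  have h := integral_fun_norm_addHaar (volume : Measure (EucN N))
    ((Iio ε).indicator fun r : ℝ => r ^ 2)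
  have hl : (fun z : EucN N => (Iio ε).indicator (fun r : ℝ => r ^ 2) ‖z‖)
      = (ball (0 : EucN N) ε).indicator fun z => ‖z‖ ^ 2 := by
    ext z
    simp [indicator_apply]
  rw [hl, integral_indicator measurableSet_ball, finrank_euclideanSpace_fin] at h
  rw [h]
  have hr : (fun y : ℝ => y ^ (N - 1) • (Iio ε).indicator (fun r : ℝ => r ^ 2) y)
      = (Iio ε).indicator fun y => y ^ (N + 1) := by
    ext y
    by_cases hy : y < ε
    · simp only [indicator_of_mem (show y ∈ Iio ε from hy), smul_eq_mul, ← pow_add]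
      congr 1; omega
    · simp [hy]
  rw [hr, setIntegral_indicator measurableSet_Iio, Ioi_inter_Iio, ← integral_Ioc_eq_integral_Ioo,
    ← intervalIntegral.integral_of_le hε.le, integral_pow, measureReal_def, measureReal_def,
    Measure.addHaar_ball_of_pos _ (0 : EucN N) hε, finrank_euclideanSpace_fin,
    ENNReal.toReal_mul, ENNReal.toReal_ofReal (by positivity)]
  simp only [nsmul_eq_mul, smul_eq_mul]
  have : (N : ℝ) + 2 ≠ 0 := by positivity
  push_cast
  field_simp
  ring

lemma integral_ball_norm_sub_sq (hN : 2 ≤ N) {ε : ℝ} (hε : 0 < ε) (x y₀ : EucN N) :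
    ∫ y in ball x ε, ‖y - y₀‖ ^ 2
      = volume.real (ball (0 : EucN N) ε) * (‖x - y₀‖ ^ 2 + N / (N + 2) * ε ^ 2) := by
  have hint : ∀ f : EucN N → ℝ, Continuous f →
      IntegrableOn f (ball (0 : EucN N) ε) := fun f hf =>
    (hf.continuousOn.integrableOn_compact (isCompact_closedBall 0 ε)).mono_set
      ball_subset_closedBall
  have hshift : ∫ y in ball x ε, ‖y - y₀‖ ^ 2
      = ∫ z in ball (0 : EucN N) ε, ‖z + (x - y₀)‖ ^ 2 := by
    rw [← (measurePreserving_add_right volume x).setIntegral_preimage_emb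
      (measurableEmbedding_addRight x)]
    simp [preimage_add_right_ball, add_sub_assoc]
  have hneg : ∫ z in ball (0 : EucN N) ε, ‖z + (x - y₀)‖ ^ 2
      = ∫ z in ball (0 : EucN N) ε, ‖-z + (x - y₀)‖ ^ 2 := by
    rw [← (Measure.measurePreserving_neg volume).setIntegral_preimage_emb
      (MeasurableEquiv.neg _).measurableEmbedding]
    simp
  have hsum : (∫ z in ball (0 : EucN N) ε, ‖z + (x - y₀)‖ ^ 2)
      + ∫ z in ball (0 : EucN N) ε, ‖-z + (x - y₀)‖ ^ 2
      = ∫ z in ball (0 : EucN N) ε, (2 * ‖z‖ ^ 2 + 2 * ‖x - y₀‖ ^ 2) := by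
    rw [← integral_add (hint _ (by fun_prop)) (hint _ (by fun_prop))]
    congr 1
    ext z
    have := parallelogram_law_with_norm ℝ (x - y₀) z
    rw [add_comm z, neg_add_eq_sub]
    nlinarith
  rw [integral_add (hint _ (by fun_prop)) (hint _ (by fun_prop)), integral_const_mul,
    integral_ball_norm_sq hN hε, setIntegral_const, smul_eq_mul] at hsum
  rw [hshift]
  linarith

lemma lintegral_gamKer_norm_sq (hN : 2 ≤ N) {p q ε : ℝ} (hp : 2 ≤ p)
    (hq : q = ((N : ℝ) + 2) / ((N : ℝ) + p)) (hε : 0 < ε) {Ω : Set (EucN N)}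
    {σ : EucN N → EucN N} (hσ : IsControl σ) (y₀ : EucN N) {x : EucN N} (hx : x ∈ closure Ω) :
    ∫⁻ y, ENNReal.ofReal (‖y - y₀‖ ^ 2) ∂(gamKer q ε Ω σ x)
      = ENNReal.ofReal (‖x - y₀‖ ^ 2 + (((N : ℝ) + p - 2) / ((N : ℝ) + p)) * ε ^ 2) := by
  have hf : Measurable fun y : EucN N => ENNReal.ofReal (‖y - y₀‖ ^ 2) := by fun_prop
  have hNp : 0 < (N : ℝ) + p := by positivity
  have hq0 : 0 ≤ q := by rw [hq]; positivity
  have hq1 : 0 ≤ (1 - q) / 2 := by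
    have : q ≤ 1 := by rw [hq, div_le_one hNp]; linarith
    linarith
  have hball : ∫⁻ y in ball x ε, ENNReal.ofReal (‖y - y₀‖ ^ 2)
      = volume (ball x ε) * ENNReal.ofReal (‖x - y₀‖ ^ 2 + N / (N + 2) * ε ^ 2) := by
    have hint : IntegrableOn (fun y : EucN N => ‖y - y₀‖ ^ 2) (ball x ε) :=
      (Continuous.continuousOn (by fun_prop)).integrableOn_compact
        (isCompact_closedBall x ε) |>.mono_set ball_subset_closedBall
    rw [← ofReal_integral_eq_lintegral_ofReal hint (ae_of_all _ fun y => by positivity),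
      integral_ball_norm_sub_sq hN hε, ENNReal.ofReal_mul measureReal_nonneg,
      ofReal_measureReal measure_ball_lt_top.ne, Measure.addHaar_ball_center volume x]
  have hv : ‖ε • σ x‖ ^ 2 = ε ^ 2 := by rw [norm_smul, hσ.2 x]; simp
  have hpar := parallelogram_law_with_norm ℝ (x - y₀) (ε • σ x)
  rw [gamKer, if_pos hx, lintegral_add_measure, lintegral_smul_measure, lintegral_smul_measure,
    lintegral_smul_measure, lintegral_add_measure, lintegral_dirac' _ hf, lintegral_dirac' _ hf,
    hball]
  simp only [smul_eq_mul]
  rw [ENNReal.inv_mul_cancel_left (measure_ball_pos _ _ hε).ne' measure_ball_lt_top.ne,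
    ← ENNReal.ofReal_add (by positivity) (by positivity), ← ENNReal.ofReal_mul hq0,
    ← ENNReal.ofReal_mul hq1, ← ENNReal.ofReal_add (by positivity) (by positivity)]
  congr 1
  have e1 : x + ε • σ x - y₀ = x - y₀ + ε • σ x := by abel
  have e2 : x - ε • σ x - y₀ = x - y₀ - ε • σ x := by abel
  have e3 : ‖x - y₀ + ε • σ x‖ ^ 2 + ‖x - y₀ - ε • σ x‖ ^ 2 = 2 * (‖x - y₀‖ ^ 2 + ε ^ 2) := by
    rw [← hv]; linarith
  rw [e1, e2, e3, hq]
  have : (N : ℝ) + 2 ≠ 0 := by positivity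
  field_simp
  ring

lemma gamKer_compl_eq_zero {q ε : ℝ} (hε : 0 < ε) {Ω : Set (EucN N)} {σ : EucN N → EucN N}
    (hσ : IsControl σ) {x : EucN N} {D : Set (EucN N)} (hD : MeasurableSet D) (hx : x ∈ D)
    (hball : x ∈ closure Ω → closedBall x ε ⊆ D) : gamKer q ε Ω σ x Dᶜ = 0 := by
  by_cases h : x ∈ closure Ω
  · have h1 : x + ε • σ x ∈ D := hball h (by
      simp [norm_smul, hσ.2 x, abs_of_pos hε])
    have h2 : x - ε • σ x ∈ D := hball h (by
      simp [norm_smul, hσ.2 x, abs_of_pos hε])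
    have h3 : Dᶜ ∩ ball x ε = ∅ := by
      ext y
      simp only [mem_inter_iff, mem_compl_iff, mem_empty_iff_false, iff_false, not_and]
      exact fun hy hy' => hy (hball h (ball_subset_closedBall hy'))
    simp [gamKer, h, Measure.restrict_apply hD.compl, h3, Measure.dirac_apply' _ hD.compl, h1, h2]
  · simp [gamKer, h, Measure.dirac_apply' _ hD.compl, hx]

lemma measurableSet_Oeps (Ω : Set (EucN N)) (ε : ℝ) : MeasurableSet (Oeps Ω ε) :=
  (isClosed_le (continuous_infDist_pt Ω) continuous_const).measurableSet

lemma measurableSet_Geps (Ω : Set (EucN N)) (ε : ℝ) : MeasurableSet (Geps Ω ε) :=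
  (measurableSet_Oeps Ω ε).diff isClosed_closure.measurableSet

lemma closedBall_subset_Oeps {Ω : Set (EucN N)} {ε : ℝ} {x : EucN N} (hx : x ∈ closure Ω) :
    closedBall x ε ⊆ Oeps Ω ε := by
  intro y hy
  have h : infDist y Ω ≤ dist y x := by
    rw [← infDist_closure]; exact infDist_le_dist_of_mem hx
  exact h.trans hy

lemma stopMin_mem (Γ : Set (EucN N)) (n : ℕ) (ω : ℕ → EucN N) :
    ω (stopMin Γ n ω) ∈ Γ ∨ stopMin Γ n ω = n :=
  Nat.sInf_mem (s := {k | ω k ∈ Γ} ∪ {n}) ⟨n, Or.inr rfl⟩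

lemma stopMin_le (Γ : Set (EucN N)) (n : ℕ) (ω : ℕ → EucN N) : stopMin Γ n ω ≤ n :=
  Nat.sInf_le (Or.inr rfl)

lemma stopMin_le_of_mem {Γ : Set (EucN N)} {n k : ℕ} {ω : ℕ → EucN N} (h : ω k ∈ Γ) :
    stopMin Γ n ω ≤ k :=
  Nat.sInf_le (Or.inl h)

lemma stopMin_eq_of_forall_notMem {Γ : Set (EucN N)} {n m : ℕ} {ω : ℕ → EucN N} (hnm : n ≤ m)
    (h : ∀ k < m, ω k ∉ Γ) : stopMin Γ n ω = n := by
  refine le_antisymm (stopMin_le _ _ _) ?_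
  rcases stopMin_mem Γ n ω with h' | h'
  · by_contra hlt
    exact h _ (by omega) h'
  · exact h'.ge

lemma stopMin_succ_of_mem {Γ : Set (EucN N)} {n k : ℕ} {ω : ℕ → EucN N} (hk : k ≤ n)
    (h : ω k ∈ Γ) : stopMin Γ (n + 1) ω = stopMin Γ n ω := by
  have h1 : ω (stopMin Γ (n + 1) ω) ∈ Γ := by
    refine (stopMin_mem Γ (n + 1) ω).resolve_right fun h' => ?_
    have := stopMin_le_of_mem (n := n + 1) h
    omega
  have h2 : ω (stopMin Γ n ω) ∈ Γ := by
    rcases stopMin_mem Γ n ω with h' | h'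
    · exact h'
    · have := stopMin_le_of_mem (n := n) h
      have hkn : k = n := by omega
      rw [h', ← hkn]; exact h
  exact le_antisymm (stopMin_le_of_mem h2) (stopMin_le_of_mem h1)

lemma measurable_eval_trajFilt {k n : ℕ} (hkn : k ≤ n) :
    Measurable[trajFilt N n] fun ω : ℕ → EucN N => ω k := by
  have h : StronglyMeasurable[trajFilt N k] fun ω : ℕ → EucN N => ω k :=
    Filtration.stronglyAdapted_natural (fun n => (measurable_pi_apply n).stronglyMeasurable) k
  exact h.measurable.mono ((trajFilt N).mono hkn) le_rfl

lemma measurableSet_forall_notMem {Γ : Set (EucN N)} (hΓ : MeasurableSet Γ) (n : ℕ) :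
    MeasurableSet[trajFilt N n] {ω : ℕ → EucN N | ∀ k ≤ n, ω k ∉ Γ} := by
  have : {ω : ℕ → EucN N | ∀ k ≤ n, ω k ∉ Γ}
      = ⋂ k, ⋂ (_ : k ≤ n), (fun ω => ω k) ⁻¹' Γᶜ := by
    ext ω; simp
  rw [this]
  exact MeasurableSet.iInter fun k => MeasurableSet.iInter fun hk =>
    measurable_eval_trajFilt hk hΓ.compl

lemma measurable_comp_stopMin {Γ : Set (EucN N)} (hΓ : MeasurableSet Γ)
    {F : ℕ → EucN N → ℝ} (hF : ∀ n, Measurable (F n)) (n : ℕ) :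
    Measurable[trajFilt N n] fun ω => F (stopMin Γ n ω) (ω (stopMin Γ n ω)) := by
  induction n with
  | zero =>
    have h0 : ∀ ω : ℕ → EucN N, stopMin Γ 0 ω = 0 := fun ω => Nat.le_zero.1 (stopMin_le _ _ _)
    simp only [h0]
    exact (hF 0).comp (measurable_eval_trajFilt le_rfl)
  | succ n ih =>
    have hS : MeasurableSet[trajFilt N (n + 1)] {ω : ℕ → EucN N | ∀ k ≤ n, ω k ∉ Γ} :=
      (trajFilt N).mono n.le_succ _ (measurableSet_forall_notMem hΓ n)
    have h1 : Measurable[trajFilt N (n + 1)] fun ω : ℕ → EucN N => F (n + 1) (ω (n + 1)) :=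
      (hF (n + 1)).comp (measurable_eval_trajFilt le_rfl)
    have h2 := @Measurable.ite _ _ _ _ (trajFilt N (n + 1)) _ (fun ω => ∀ k ≤ n, ω k ∉ Γ)
      (fun _ => Classical.propDecidable _) hS h1
      (ih.mono ((trajFilt N).mono n.le_succ) le_rfl)
    convert h2 using 2 with ω
    split_ifs with h
    · rw [stopMin_eq_of_forall_notMem le_rfl fun k hk => h k (by omega)]
    · simp only [not_forall, not_not] at h
      obtain ⟨k, hk, hkΓ⟩ := h
      rw [stopMin_succ_of_mem hk hkΓ]

/-- `|x_{n∧τ_σ} - y₀|² - c_{N,p} (n∧τ_σ) ε²`, `n ≥ 1`, is a martingale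
(adaptedness and the conditional-expectation martingale property for indices `≥ 1`). -/
theorem stopped_square_martingale (hN : 2 ≤ N) (p q ε : ℝ) (hp : 2 ≤ p)
    (hq : q = ((N : ℝ) + 2) / ((N : ℝ) + p)) (hε : 0 < ε)
    (Ω : Set (EucN N)) (hΩo : IsOpen Ω) (hΩb : Bornology.IsBounded Ω)
    (σ : EucN N → EucN N) (hσ : IsControl σ)
    (x₀ : EucN N) (hx₀ : x₀ ∈ Oeps Ω ε)
    (P : Measure (ℕ → EucN N)) (hP : IsTrajMeasure (gamKer q ε Ω σ) x₀ P)
    (y₀ : EucN N) :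
    (∀ n : ℕ, 1 ≤ n → StronglyMeasurable[trajFilt N n]
      (fun ω => ‖ω (stopMin (Geps Ω ε) n ω) - y₀‖ ^ 2
        - (((N : ℝ) + p - 2) / ((N : ℝ) + p)) * (stopMin (Geps Ω ε) n ω) * ε ^ 2)) ∧
    (∀ n : ℕ, 1 ≤ n → Integrable
      (fun ω => ‖ω (stopMin (Geps Ω ε) n ω) - y₀‖ ^ 2
        - (((N : ℝ) + p - 2) / ((N : ℝ) + p)) * (stopMin (Geps Ω ε) n ω) * ε ^ 2) P) ∧
    ∀ m n : ℕ, 1 ≤ m → m ≤ n →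
      (P[(fun ω => ‖ω (stopMin (Geps Ω ε) n ω) - y₀‖ ^ 2
          - (((N : ℝ) + p - 2) / ((N : ℝ) + p)) * (stopMin (Geps Ω ε) n ω) * ε ^ 2)
        | trajFilt N m])
      =ᵐ[P] (fun ω => ‖ω (stopMin (Geps Ω ε) m ω) - y₀‖ ^ 2
          - (((N : ℝ) + p - 2) / ((N : ℝ) + p)) * (stopMin (Geps Ω ε) m ω) * ε ^ 2) := by
  set c : ℝ := ((N : ℝ) + p - 2) / ((N : ℝ) + p)
  set Γ := Geps Ω ε
  have := hP.1
  have hγ : Measurable (gamKer q ε Ω σ) := measurable_gamKer q ε Ω hσ.1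
  have hΓ : MeasurableSet Γ := measurableSet_Geps Ω ε
  have hc0 : 0 ≤ c := div_nonneg (by linarith [(Nat.cast_nonneg N : (0 : ℝ) ≤ N)]) (by positivity)
  let M : ℕ → (ℕ → EucN N) → ℝ := fun n ω =>
    ‖ω (stopMin Γ n ω) - y₀‖ ^ 2 - c * (stopMin Γ n ω) * ε ^ 2
  have hmeas : ∀ n, StronglyMeasurable[trajFilt N n] (M n) := fun n =>
    (measurable_comp_stopMin hΓ (F := fun k x => ‖x - y₀‖ ^ 2 - c * k * ε ^ 2)
      (fun k => by fun_prop) n).stronglyMeasurable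
  have hmem : ∀ᵐ ω ∂P, ∀ n : ℕ, ω n ∈ closedBall x₀ (n * ε) ∩ Oeps Ω ε := by
    refine ae_all_iff.2 (hP.ae_mem hγ (D := fun n => closedBall x₀ (n * ε) ∩ Oeps Ω ε)
      (fun n => isClosed_closedBall.measurableSet.inter (measurableSet_Oeps Ω ε))
      ⟨by simp, hx₀⟩ fun n x hx => ?_)
    have hsucc : ((n + 1 : ℕ) : ℝ) * ε = ε + n * ε := by push_cast; ring
    refine gamKer_compl_eq_zero hε hσ
      (isClosed_closedBall.measurableSet.inter (measurableSet_Oeps Ω ε)) ⟨?_, hx.2⟩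
      fun h y hy => ⟨?_, closedBall_subset_Oeps h hy⟩
    · exact closedBall_subset_closedBall (by rw [hsucc]; linarith) hx.1
    · rw [mem_closedBall, hsucc]
      exact (dist_triangle y x x₀).trans (add_le_add hy hx.1)
  have hbound : ∀ᵐ ω ∂P, ∀ n k : ℕ, k ≤ n →
      ‖ω k - y₀‖ ^ 2 ≤ (n * ε + ‖x₀ - y₀‖) ^ 2 := by
    filter_upwards [hmem] with ω hω n k hk
    have h1 : ‖ω k - x₀‖ ≤ k * ε := by rw [← dist_eq_norm]; exact (hω k).1
    have h2 : (k : ℝ) * ε ≤ n * ε := by gcongr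
    gcongr
    linarith [norm_sub_le_norm_sub_add_norm_sub (ω k) x₀ y₀]
  have hint : ∀ n, Integrable (M n) P := by
    intro n
    refine Integrable.of_bound ((hmeas n).mono ((trajFilt N).le n)).aestronglyMeasurable
      ((n * ε + ‖x₀ - y₀‖) ^ 2 + c * n * ε ^ 2) ?_
    filter_upwards [hbound] with ω hω
    have h1 := hω n _ (stopMin_le Γ n ω)
    have h2 : c * (stopMin Γ n ω) * ε ^ 2 ≤ c * n * ε ^ 2 := by
      gcongr
      exact stopMin_le Γ n ω
    have h3 : 0 ≤ c * (stopMin Γ n ω) * ε ^ 2 := by positivity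
    rw [Real.norm_eq_abs, abs_le]
    constructor <;> simp only [M] <;> nlinarith [sq_nonneg ‖ω (stopMin Γ n ω) - y₀‖]
  have hsq : ∀ n : ℕ, Integrable (fun ω : ℕ → EucN N => ‖ω n - y₀‖ ^ 2) P := by
    intro n
    refine Integrable.of_bound (Measurable.aestronglyMeasurable (by fun_prop))
      ((n * ε + ‖x₀ - y₀‖) ^ 2) ?_
    filter_upwards [hbound] with ω hω
    rw [Real.norm_of_nonneg (by positivity)]
    exact hω n n le_rfl
  have hmart : Martingale M (trajFilt N) P := by
    refine martingale_of_setIntegral_eq_succ hmeas hint fun n S hS => ?_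
    set R : Set (ℕ → EucN N) := {ω | ∀ k ≤ n, ω k ∉ Γ}
    have hR : MeasurableSet[trajFilt N n] R := measurableSet_forall_notMem hΓ n
    have hT : MeasurableSet[trajFilt N n] (S ∩ R) := hS.inter hR
    have hdiff : ∀ ω, M (n + 1) ω - M n ω
        = R.indicator (fun ω => ‖ω (n + 1) - y₀‖ ^ 2 - (‖ω n - y₀‖ ^ 2 + c * ε ^ 2)) ω := by
      intro ω
      by_cases hω : ω ∈ R
      · have h1 : stopMin Γ (n + 1) ω = n + 1 :=
          stopMin_eq_of_forall_notMem le_rfl fun k hk => hω k (by omega)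
        have h2 : stopMin Γ n ω = n :=
          stopMin_eq_of_forall_notMem le_rfl fun k hk => hω k hk.le
        simp only [M, indicator_of_mem hω, h1, h2]
        push_cast
        ring
      · have hω' := hω
        simp only [R, mem_ofPred_eq, not_forall, not_not] at hω'
        obtain ⟨k, hk, hkΓ⟩ := hω'
        simp only [M, indicator_of_notMem hω, stopMin_succ_of_mem hk hkΓ, sub_self]
    have hlint : ∫⁻ ω in S ∩ R, ENNReal.ofReal (‖ω (n + 1) - y₀‖ ^ 2) ∂P
        = ∫⁻ ω in S ∩ R, ENNReal.ofReal (‖ω n - y₀‖ ^ 2 + c * ε ^ 2) ∂P := by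
      rw [hP.setLIntegral_succ hγ n (f := fun y => ENNReal.ofReal (‖y - y₀‖ ^ 2))
        (by fun_prop) (hsq (n + 1)).lintegral_lt_top.ne hT]
      refine lintegral_congr_ae ((ae_restrict_iff' ((trajFilt N).le n _ hT)).2 ?_)
      filter_upwards [hmem] with ω hω hωT
      have hcl : ω n ∈ closure Ω := by
        by_contra h
        exact hωT.2 n le_rfl ⟨(hω n).2, h⟩
      exact lintegral_gamKer_norm_sq hN hp hq hε hσ y₀ hcl
    have heq : ∫ ω in S ∩ R, ‖ω (n + 1) - y₀‖ ^ 2 ∂P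
        = ∫ ω in S ∩ R, (‖ω n - y₀‖ ^ 2 + c * ε ^ 2) ∂P := by
      rw [integral_eq_lintegral_of_nonneg_ae (ae_of_all _ fun ω => by positivity)
          (Measurable.aestronglyMeasurable (by fun_prop)),
        integral_eq_lintegral_of_nonneg_ae (ae_of_all _ fun ω => by positivity)
          (Measurable.aestronglyMeasurable (by fun_prop)), hlint]
    have hsq' : Integrable (fun ω : ℕ → EucN N => ‖ω n - y₀‖ ^ 2 + c * ε ^ 2) P :=
      (hsq n).add (integrable_const _)
    have hzero : ∫ ω in S, (M (n + 1) ω - M n ω) ∂P = 0 := by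
      simp only [hdiff]
      rw [setIntegral_indicator ((trajFilt N).le n _ hR),
        integral_sub (hsq (n + 1)).integrableOn hsq'.integrableOn, heq, sub_self]
    rw [integral_sub (hint (n + 1)).integrableOn (hint n).integrableOn] at hzero
    linarith
  exact ⟨fun n _ => hmeas n, fun n _ => hint n, fun m n _ hmn => hmart.2 m n hmn⟩

end
end
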